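/- Let q : G̃ → G be a surjective group homomorphism, let S̃ be a finite semigroup-generating set of G̃ on which q is injective, set S := q(S̃), and let π be a positive weight function on S̃, transported to S via the bijection q|_{S̃}. If Δ̃ is an essentially geodesic generating set (egg) for (G̃, S̃, π), then the set Δ of words over S obtained by applying q letterwise to the words of Δ̃ is an egg for (G, S, π). -/

import Mathlib

/-- The `π`-length of a word `w` over the group `G`: the sum of the weights of its letters. -/
noncomputable def wlen {G : Type*} (π : G → ℝ) (w : List G) : ℝ := (w.map π).sum

/-- The weighted word norm of `g` with respect to the generating set `S` and weight `π`:
the infimum of the `π`-lengths of words over `S` evaluating to `g`. -/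
noncomputable def wnorm {G : Type*} [Group G] (S : Set G) (π : G → ℝ) (g : G) : ℝ :=
  sInf {r : ℝ | ∃ w : List G, (∀ x ∈ w, x ∈ S) ∧ w.prod = g ∧ wlen π w = r}

/-- A finite set `Δ` of words over `S` is an essentially geodesic generating set (egg)
for `(G,S,π)`. -/
def IsEgg {G : Type*} [Group G] (S : Set G) (π : G → ℝ) (Δ : Set (List G)) : Prop :=
  Δ.Finite ∧ (∀ w ∈ Δ, ∀ x ∈ w, x ∈ S) ∧
  ∃ F : Set (List G), F.Finite ∧ (∀ w ∈ F, ∀ x ∈ w, x ∈ S) ∧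
    ∀ g : G, ∃ (ds : List (List G)) (h : List G),
      (∀ d ∈ ds, d ∈ Δ) ∧ h ∈ F ∧
      (ds.flatten ++ h).prod = g ∧ wlen π (ds.flatten ++ h) = wnorm S π g

theorem wlen_nonneg {G : Type*} {S : Set G} {π : G → ℝ} (hπ : ∀ s ∈ S, 0 < π s)
    {w : List G} (hw : ∀ x ∈ w, x ∈ S) : 0 ≤ wlen π w :=
  List.sum_nonneg (List.forall_mem_map.2 fun x hx => (hπ x (hw x hx)).le)

theorem wnorm_le_wlen {G : Type*} [Group G] {S : Set G} {π : G → ℝ} (hπ : ∀ s ∈ S, 0 < π s)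
    {g : G} {w : List G} (hw : ∀ x ∈ w, x ∈ S) (hg : w.prod = g) : wnorm S π g ≤ wlen π w :=
  csInf_le ⟨0, by rintro _ ⟨v, hv, -, rfl⟩; exact wlen_nonneg hπ hv⟩ ⟨w, hw, hg, rfl⟩

/-- For positive weights on a finite set the infimum defining the word norm is attained. -/
theorem exists_wlen_eq_wnorm {G : Type*} [Group G] {S : Set G} (hS : S.Finite) {π : G → ℝ}
    (hπ : ∀ s ∈ S, 0 < π s) {g : G} (hg : ∃ w : List G, (∀ x ∈ w, x ∈ S) ∧ w.prod = g) :
    ∃ w : List G, (∀ x ∈ w, x ∈ S) ∧ w.prod = g ∧ wlen π w = wnorm S π g := by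
  have hpwo : (AddSubmonoid.closure (π '' S) : Set ℝ).IsPWO :=
    Set.IsPWO.addSubmonoid_closure (Set.forall_mem_image.2 fun s hs => (hπ s hs).le)
      (hS.image π).isPWO
  have hwf : {r : ℝ | ∃ w : List G, (∀ x ∈ w, x ∈ S) ∧ w.prod = g ∧ wlen π w = r}.IsWF := by
    refine (hpwo.mono ?_).isWF
    rintro _ ⟨w, hw, -, rfl⟩
    exact list_sum_mem (List.forall_mem_map.2 fun x hx =>
      AddSubmonoid.subset_closure (Set.mem_image_of_mem π (hw x hx)))
  obtain ⟨v, hv, hvg⟩ := hg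
  have hne : {r : ℝ | ∃ w : List G, (∀ x ∈ w, x ∈ S) ∧ w.prod = g ∧ wlen π w = r}.Nonempty :=
    ⟨_, v, hv, hvg, rfl⟩
  exact IsLeast.csInf_mem ⟨hwf.min_mem hne, fun _ hr => hwf.min_le hne hr⟩

theorem exists_map_eq_of_forall_mem_image {α β : Type*} {f : α → β} {S : Set α} {w : List β}
    (hw : ∀ x ∈ w, x ∈ f '' S) : ∃ v : List α, (∀ x ∈ v, x ∈ S) ∧ v.map f = w := by
  induction w with
  | nil => exact ⟨[], by simp, rfl⟩
  | cons a w ih =>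
    obtain ⟨⟨b, hb, rfl⟩, hw'⟩ := List.forall_mem_cons.1 hw
    obtain ⟨v, hv, rfl⟩ := ih hw'
    exact ⟨b :: v, List.forall_mem_cons.2 ⟨hb, hv⟩, rfl⟩

theorem exists_word_image {H G : Type*} [Group H] [Group G] {q : H →* G}
    (hq : Function.Surjective q) {S : Set H}
    (hS : ∀ g : H, ∃ w : List H, (∀ x ∈ w, x ∈ S) ∧ w.prod = g) (g : G) :
    ∃ w : List G, (∀ x ∈ w, x ∈ q '' S) ∧ w.prod = g := by
  obtain ⟨a, rfl⟩ := hq g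
  obtain ⟨w, hw, rfl⟩ := hS a
  exact ⟨w.map q, List.forall_mem_map.2 fun x hx => Set.mem_image_of_mem q (hw x hx),
    (map_list_prod q w).symm⟩

theorem wlen_map {H G : Type*} {q : H → G} {S : Set H} {ρ : H → ℝ} {π : G → ℝ}
    (h : ∀ s ∈ S, π (q s) = ρ s) {w : List H} (hw : ∀ x ∈ w, x ∈ S) :
    wlen π (w.map q) = wlen ρ w := by
  unfold wlen
  rw [List.map_map]
  exact congrArg List.sum (List.map_congr_left fun x hx => h x (hw x hx))

/-- eggs push forward to quotients.  Here `q : G̃ → G` is a surjective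
homomorphism, injective on the finite generating set `S̃` of `G̃`, `S = q(S̃)`, and
the weight `πt` on `S̃` is transported to `π` on `S`.  If `Δ̃` is an egg for
`(G̃, S̃, πt)` then its letterwise image under `q` is an egg for `(G, S, π)`. -/
theorem isEgg_quotient {Gt G : Type*} [Group Gt] [Group G]
    (q : Gt →* G) (hq : Function.Surjective q)
    (St : Set Gt) (hStfin : St.Finite) (hStone : (1 : Gt) ∉ St)
    (hStgen : ∀ g : Gt, ∃ w : List Gt, (∀ x ∈ w, x ∈ St) ∧ w.prod = g)
    (hqinj : Set.InjOn q St)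
    (πt : Gt → ℝ) (hπt : ∀ s ∈ St, 0 < πt s)
    (π : G → ℝ) (hπq : ∀ s ∈ St, π (q s) = πt s)
    (Δt : Set (List Gt)) (hΔt : IsEgg St πt Δt) :
    IsEgg (q '' St) π ((List.map q) '' Δt) := by
  obtain ⟨hfin, hsub, F, hF, hFS, hrep⟩ := hΔt
  have hmap : ∀ w : List Gt, (∀ x ∈ w, x ∈ St) → ∀ x ∈ w.map q, x ∈ q '' St := fun w hw =>
    List.forall_mem_map.2 fun x hx => Set.mem_image_of_mem q (hw x hx)
  have hpos : ∀ s ∈ q '' St, 0 < π s := by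
    rintro _ ⟨s, hs, rfl⟩
    rw [hπq s hs]
    exact hπt s hs
  refine ⟨hfin.image _, Set.forall_mem_image.2 fun w hw => hmap w (hsub w hw),
    List.map q '' F, hF.image _, Set.forall_mem_image.2 fun w hw => hmap w (hFS w hw), fun g => ?_⟩
  obtain ⟨w, hwS, hwg, hwlen⟩ :=
    exists_wlen_eq_wnorm (hStfin.image q) hpos (exists_word_image hq hStgen g)
  obtain ⟨v, hvS, rfl⟩ := exists_map_eq_of_forall_mem_image hwS
  obtain ⟨ds, h, hds, hh, hprod, hlen⟩ := hrep v.prod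
  have hdsS : ∀ x ∈ ds.flatten ++ h, x ∈ St := by
    intro x hx
    rcases List.mem_append.1 hx with hx | hx
    · obtain ⟨d, hd, hxd⟩ := List.mem_flatten.1 hx
      exact hsub d (hds d hd) x hxd
    · exact hFS h hh x hx
  have hprod' : ((ds.flatten ++ h).map q).prod = g := by
    rw [← map_list_prod, hprod, map_list_prod, hwg]
  have heq : (ds.map (List.map q)).flatten ++ h.map q = (ds.flatten ++ h).map q := by
    rw [List.map_append, List.map_flatten]
  refine ⟨ds.map (List.map q), h.map q,
    List.forall_mem_map.2 fun d hd => Set.mem_image_of_mem _ (hds d hd),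
    Set.mem_image_of_mem _ hh, ?_, ?_⟩
  · rw [heq, hprod']
  · rw [heq]
    refine le_antisymm ?_ (wnorm_le_wlen hpos (hmap _ hdsS) hprod')
    rw [← hwlen, wlen_map hπq hdsS, wlen_map hπq hvS, hlen]
    exact wnorm_le_wlen hπt hvS rfl
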